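/- Let d ≥ 1, let β ∈ ℕ^d be a multiindex, and let f : ℝ^d → ℝ be such that all mixed partial derivatives ∂^γ f for γ ≤ β exist and are continuous. Then for every multiindex α ∈ ℕ^d with α_i > β_i for all i, the supremum over x ∈ [0,1]^d of |∂^β B_α(f)(x)| is at most the supremum over x ∈ [0,1]^d of |∂^β f(x)|. -/

import Mathlib

/-- Partial derivative in the `i`-th coordinate. -/
noncomputable def partialDeriv (d : ℕ) (i : Fin d) (f : (Fin d → ℝ) → ℝ) :
    (Fin d → ℝ) → ℝ :=
  fun x => deriv (fun t => f (Function.update x i t)) (x i)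

/-- The mixed partial derivative `∂^β = ∂^{β 0}_{x_0} ⋯ ∂^{β (d-1)}_{x_{d-1}}`. -/
noncomputable def mixedPartial (d : ℕ) (β : Fin d → ℕ) (f : (Fin d → ℝ) → ℝ) :
    (Fin d → ℝ) → ℝ :=
  (List.finRange d).foldr (fun i g => (partialDeriv d i)^[β i] g) f

/-- The multivariate Bernstein polynomial `B_α(f)`. -/
noncomputable def multiBernstein (d : ℕ) (α : Fin d → ℕ) (f : (Fin d → ℝ) → ℝ)
    (x : Fin d → ℝ) : ℝ :=
  ∑ β : (i : Fin d) → Fin (α i + 1),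
    (∏ i, ((α i).choose (β i) : ℝ)) * f (fun i => ((β i : ℕ) : ℝ) / (α i : ℝ)) *
      ∏ i, (x i) ^ (β i : ℕ) * (1 - x i) ^ (α i - (β i : ℕ))

/-- `f` has all mixed partial derivatives `∂^γ f` for `γ ≤ β`, and they are continuous. -/
def HasContMixedPartials (d : ℕ) (β : Fin d → ℕ) (f : (Fin d → ℝ) → ℝ) : Prop :=
  ∀ γ : Fin d → ℕ, γ ≤ β →
    Continuous (mixedPartial d γ f) ∧
    ∀ i : Fin d, γ i < β i → ∀ x : Fin d → ℝ,
      DifferentiableAt ℝ (fun t => mixedPartial d γ f (Function.update x i t)) (x i)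

section Quadrature

open Finset Polynomial

/-- The polynomial `∑ k ≤ n, a k * b_{n,k}` with Bernstein coefficients `a`. -/
noncomputable def bernsteinSum (n : ℕ) (a : ℕ → ℝ) : ℝ[X] :=
  ∑ k ∈ range (n + 1), C (a k) * bernsteinPolynomial ℝ n k

lemma derivative_bernsteinSum (n : ℕ) (a : ℕ → ℝ) :
    derivative (bernsteinSum (n + 1) a) =
      C ((n : ℝ) + 1) * bernsteinSum n (fun k => a (k + 1) - a k) := by
  have hlast : bernsteinPolynomial ℝ n (n + 1) = 0 :=
    bernsteinPolynomial.eq_zero_of_lt ℝ (Nat.lt_succ_self n)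
  have hshift : ∑ k ∈ range (n + 1), C (a (k + 1)) * bernsteinPolynomial ℝ n (k + 1)
      + C (a 0) * bernsteinPolynomial ℝ n 0
      = ∑ k ∈ range (n + 1), C (a k) * bernsteinPolynomial ℝ n k := by
    rw [← Finset.sum_range_succ' (fun k => C (a k) * bernsteinPolynomial ℝ n k),
      Finset.sum_range_succ, hlast, mul_zero, add_zero]
  unfold bernsteinSum
  rw [Finset.sum_range_succ', derivative_add, derivative_sum]
  simp only [derivative_C_mul, bernsteinPolynomial.derivative_succ,
    bernsteinPolynomial.derivative_zero, Nat.add_sub_cancel, C_sub, sub_mul, mul_sub,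
    Finset.sum_sub_distrib]
  rw [← hshift, mul_add, Finset.mul_sum, Finset.mul_sum]
  have hC : C ((n : ℝ) + 1) = (((n + 1 : ℕ) : ℝ[X])) := by simp
  rw [hC]
  simp only [mul_left_comm (C _)]
  ring

lemma abs_eval_bernsteinSum_le {n : ℕ} {a : ℕ → ℝ} {M x : ℝ} (hx : x ∈ Set.Icc (0 : ℝ) 1)
    (ha : ∀ k ≤ n, |a k| ≤ M) : |(bernsteinSum n a).eval x| ≤ M := by
  have hb : ∀ k, 0 ≤ (bernsteinPolynomial ℝ n k).eval x := by
    intro k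
    have h1 : 0 ≤ 1 - x := sub_nonneg.2 hx.2
    have h0 := hx.1
    simp only [bernsteinPolynomial, eval_mul, eval_natCast, eval_pow, eval_X, eval_sub, eval_one]
    positivity
  have hsum : ∑ k ∈ range (n + 1), (bernsteinPolynomial ℝ n k).eval x = 1 := by
    rw [← eval_finsetSum, bernsteinPolynomial.sum, eval_one]
  unfold bernsteinSum
  rw [eval_finsetSum]
  calc _ ≤ ∑ k ∈ range (n + 1), |(C (a k) * bernsteinPolynomial ℝ n k).eval x| :=
        Finset.abs_sum_le_sum_abs _ _
    _ ≤ ∑ k ∈ range (n + 1), M * (bernsteinPolynomial ℝ n k).eval x := by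
        refine Finset.sum_le_sum fun k hk => ?_
        rw [eval_mul, eval_C, abs_mul, abs_of_nonneg (hb k)]
        exact mul_le_mul_of_nonneg_right (ha k (by simpa [Nat.lt_succ_iff] using hk)) (hb k)
    _ = M := by rw [← Finset.mul_sum, hsum, mul_one]

/-- Here `G j` plays the role of the `j`-th derivative of `G 0`. -/
lemma abs_iterate_derivative_bernsteinSum_le {h x : ℝ} (hh : 0 ≤ h)
    (hx : x ∈ Set.Icc (0 : ℝ) 1) (n m : ℕ) (G : ℕ → ℝ → ℝ) (M : ℝ)
    (hG : ∀ j < m, ∀ t, HasDerivAt (G j) (G (j + 1) t) t)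
    (hM : ∀ t ∈ Set.Icc (0 : ℝ) ((n + m : ℕ) * h), |G m t| ≤ M) :
    |(derivative^[m] (bernsteinSum (n + m) (fun k => G 0 (k * h)))).eval x| ≤
      (n + m).descFactorial m * h ^ m * M := by
  induction m generalizing G M with
  | zero =>
    simp only [Function.iterate_zero, id, Nat.descFactorial_zero, Nat.cast_one, pow_zero, one_mul]
    refine abs_eval_bernsteinSum_le hx fun k hk => hM _ ⟨by positivity, ?_⟩
    have : (k : ℝ) ≤ (n + 0 : ℕ) := by exact_mod_cast hk
    exact mul_le_mul_of_nonneg_right this hh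
  | succ m ih =>
    rw [Function.iterate_succ_apply, ← add_assoc, derivative_bernsteinSum,
      iterate_derivative_C_mul, eval_mul, eval_C, abs_mul,
      abs_of_nonneg (by positivity : (0 : ℝ) ≤ (n + m : ℕ) + 1)]
    have key := ih (fun j t => G j (t + h) - G j t) (h * M)
      (fun j hj t => ((hG j (by omega) (t + h)).comp_add_const t h).sub (hG j (by omega) t)) ?_
    · have hfun : (fun k : ℕ => G 0 (((k + 1 : ℕ) : ℝ) * h) - G 0 (k * h))
          = fun k : ℕ => G 0 (k * h + h) - G 0 (k * h) := by
        funext k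
        push_cast
        rw [add_mul, one_mul]
      rw [hfun, Nat.succ_descFactorial_succ]
      calc _ ≤ (((n + m : ℕ) : ℝ) + 1) * ((n + m).descFactorial m * h ^ m * (h * M)) :=
            mul_le_mul_of_nonneg_left key (by positivity)
        _ = _ := by push_cast; ring
    · intro t ht
      have hmv := Convex.norm_image_sub_le_of_norm_hasDerivWithin_le
        (f := G m) (f' := G (m + 1)) (C := M) (s := Set.Icc (0 : ℝ) ((n + (m + 1) : ℕ) * h))
        (x := t) (y := t + h) (fun u _ => (hG m (by omega) u).hasDerivWithinAt)
        (fun u hu => by simpa using hM u hu) (convex_Icc _ _)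
        ⟨ht.1, ?_⟩ ⟨by linarith [ht.1], ?_⟩
      · simp only [add_sub_cancel_left, Real.norm_eq_abs, abs_of_nonneg hh] at hmv
        rwa [mul_comm]
      all_goals
        have := ht.2
        push_cast at this ⊢
        nlinarith

lemma abs_sum_iterate_derivative_bernstein_le {n m : ℕ} (hmn : m < n) {x : ℝ}
    (hx : x ∈ Set.Icc (0 : ℝ) 1) (G : ℕ → ℝ → ℝ) (M : ℝ)
    (hG : ∀ j < m, ∀ t, HasDerivAt (G j) (G (j + 1) t) t)
    (hM : ∀ t ∈ Set.Icc (0 : ℝ) 1, |G m t| ≤ M) :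
    |∑ k : Fin (n + 1), (derivative^[m] (bernsteinPolynomial ℝ n k)).eval x *
      G 0 ((k : ℕ) / (n : ℝ))| ≤ M := by
  have hn : (0 : ℝ) < n := by exact_mod_cast (by omega : 0 < n)
  have hM0 : 0 ≤ M := (abs_nonneg _).trans (hM 0 (by simp))
  have key := abs_iterate_derivative_bernsteinSum_le (h := (n : ℝ)⁻¹) (by positivity) hx
    (n - m) m G M hG
  rw [Nat.sub_add_cancel hmn.le, mul_inv_cancel₀ hn.ne'] at key
  have hsum : ∑ k : Fin (n + 1), (derivative^[m] (bernsteinPolynomial ℝ n k)).eval x *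
      G 0 ((k : ℕ) / (n : ℝ)) =
      (derivative^[m] (bernsteinSum n (fun k => G 0 (k * (n : ℝ)⁻¹)))).eval x := by
    unfold bernsteinSum
    rw [Finset.sum_range, iterate_derivative_sum, eval_finsetSum]
    refine Finset.sum_congr rfl fun k _ => ?_
    rw [iterate_derivative_C_mul, eval_mul, eval_C, mul_comm, div_eq_mul_inv]
  rw [hsum]
  refine (key hM).trans ?_
  have hdf : ((n.descFactorial m : ℕ) : ℝ) ≤ (n : ℝ) ^ m := by
    exact_mod_cast Nat.descFactorial_le_pow n m
  have : ((n.descFactorial m : ℕ) : ℝ) * (n : ℝ)⁻¹ ^ m ≤ 1 := by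
    rw [inv_pow, ← div_eq_mul_inv]
    exact div_le_one_of_le₀ hdf (by positivity)
  calc _ ≤ 1 * M := mul_le_mul_of_nonneg_right this hM0
    _ = M := one_mul M

variable {d : ℕ}

/-- Weighted sum of the values of `g` over the nodes `j / α i` in the `i`-th coordinate. -/
noncomputable def coordSum (α : Fin d → ℕ) (w : Fin d → ℕ → ℝ) (i : Fin d)
    (g : (Fin d → ℝ) → ℝ) : (Fin d → ℝ) → ℝ :=
  fun x => ∑ j : Fin (α i + 1), w i j * g (Function.update x i ((j : ℕ) / (α i : ℝ)))

/-- Iteration of `coordSum` over a list of coordinates. -/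
noncomputable def listSum (α : Fin d → ℕ) (w : Fin d → ℕ → ℝ) (l : List (Fin d))
    (g : (Fin d → ℝ) → ℝ) : (Fin d → ℝ) → ℝ :=
  l.foldr (coordSum α w) g

lemma coordSum_comm (α : Fin d → ℕ) (w : Fin d → ℕ → ℝ) {i j : Fin d} (hij : i ≠ j)
    (g : (Fin d → ℝ) → ℝ) :
    coordSum α w i (coordSum α w j g) = coordSum α w j (coordSum α w i g) := by
  funext x
  simp only [coordSum, Finset.mul_sum]
  rw [Finset.sum_comm]
  refine Finset.sum_congr rfl fun a _ => Finset.sum_congr rfl fun b _ => ?_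
  rw [Function.update_comm hij]
  ring

lemma listSum_coordSum (α : Fin d → ℕ) (w : Fin d → ℕ → ℝ) (l : List (Fin d)) {i : Fin d}
    (hi : i ∉ l) (g : (Fin d → ℝ) → ℝ) :
    listSum α w l (coordSum α w i g) = coordSum α w i (listSum α w l g) := by
  induction l with
  | nil => rfl
  | cons j l ih =>
    simp only [List.mem_cons, not_or] at hi
    change coordSum α w j (listSum α w l _) = coordSum α w i (coordSum α w j (listSum α w l g))
    rw [ih hi.2, coordSum_comm α w hi.1]

lemma hasDerivAt_coordSum (α : Fin d → ℕ) (w : Fin d → ℕ → ℝ) {i j : Fin d} (hij : i ≠ j)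
    {g g' : (Fin d → ℝ) → ℝ}
    (hg : ∀ x, HasDerivAt (fun t => g (Function.update x i t)) (g' x) (x i)) (x : Fin d → ℝ) :
    HasDerivAt (fun t => coordSum α w j g (Function.update x i t)) (coordSum α w j g' x)
      (x i) := by
  unfold coordSum
  refine HasDerivAt.fun_sum fun a _ => ?_
  have h := (hg (Function.update x j ((a : ℕ) / (α j : ℝ)))).const_mul (w j a)
  rw [Function.update_of_ne hij] at h
  simpa only [Function.update_comm hij] using h

lemma hasDerivAt_listSum (α : Fin d → ℕ) (w : Fin d → ℕ → ℝ) (l : List (Fin d)) {i : Fin d}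
    (hi : i ∉ l) {g g' : (Fin d → ℝ) → ℝ}
    (hg : ∀ x, HasDerivAt (fun t => g (Function.update x i t)) (g' x) (x i)) (x : Fin d → ℝ) :
    HasDerivAt (fun t => listSum α w l g (Function.update x i t)) (listSum α w l g' x)
      (x i) := by
  induction l generalizing x with
  | nil => exact hg x
  | cons j l ih =>
    simp only [List.mem_cons, not_or] at hi
    exact hasDerivAt_coordSum α w hi.1 (ih hi.2) x

/-- Iterated partial derivatives `∂_i^{β i}` over a list of coordinates. -/
noncomputable def listPartial (β : Fin d → ℕ) (l : List (Fin d)) (g : (Fin d → ℝ) → ℝ) :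
    (Fin d → ℝ) → ℝ :=
  l.foldr (fun i g => (partialDeriv d i)^[β i] g) g

lemma abs_listSum_le (α β : Fin d → ℕ) (hβα : ∀ i, β i < α i) {y : Fin d → ℝ}
    (hy : y ∈ Set.Icc (0 : Fin d → ℝ) 1) (M : ℝ) (l : List (Fin d)) (hl : l.Nodup)
    (g : (Fin d → ℝ) → ℝ)
    (hdiff : ∀ l₁ i l₂, l = l₁ ++ i :: l₂ → ∀ j < β i, ∀ x : Fin d → ℝ,
      DifferentiableAt ℝ
        (fun t => (partialDeriv d i)^[j] (listPartial β l₂ g) (Function.update x i t)) (x i))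
    (hM : ∀ x ∈ Set.Icc (0 : Fin d → ℝ) 1, |listPartial β l g x| ≤ M)
    {x : Fin d → ℝ} (hx : x ∈ Set.Icc (0 : Fin d → ℝ) 1) :
    |listSum α (fun i k => (derivative^[β i] (bernsteinPolynomial ℝ (α i) k)).eval (y i)) l g x|
      ≤ M := by
  induction l using List.reverseRecOn generalizing g x with
  | nil => exact hM x hx
  | append_singleton l i ih =>
    have hil : i ∉ l := by
      intro h
      exact (List.disjoint_of_nodup_append hl) h (by simp)
    set w : Fin d → ℕ → ℝ :=
      fun i k => (derivative^[β i] (bernsteinPolynomial ℝ (α i) k)).eval (y i) with hw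
    have hstep : listSum α w (l ++ [i]) g = coordSum α w i (listSum α w l g) := by
      rw [← listSum_coordSum α w l hil]
      simp [listSum]
    rw [hstep]
    refine abs_sum_iterate_derivative_bernstein_le (hβα i) ⟨hy.1 i, hy.2 i⟩
      (fun j t => listSum α w l ((partialDeriv d i)^[j] g) (Function.update x i t)) M ?_ ?_
    · intro j hj t
      have hd : ∀ z, HasDerivAt
          (fun t => (partialDeriv d i)^[j] g (Function.update z i t))
          ((partialDeriv d i)^[j + 1] g z) (z i) := by
        intro z
        rw [Function.iterate_succ_apply']
        exact (hdiff l i [] rfl j hj z).hasDerivAt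
      simpa using hasDerivAt_listSum α w l hil hd (Function.update x i t)
    · intro t ht
      refine ih (List.Nodup.of_append_left hl) _ ?_ ?_ ?_
      · intro l₁ i' l₂ h j hj z
        have := hdiff l₁ i' (l₂ ++ [i]) (by simp [h]) j hj z
        simpa [listPartial] using this
      · intro z hz
        simpa [listPartial] using hM z hz
      · refine ⟨fun k => ?_, fun k => ?_⟩
        all_goals
          rcases eq_or_ne k i with rfl | hk
          · simpa using (by first | exact ht.1 | exact ht.2)
          · simpa [hk] using (by first | exact hx.1 k | exact hx.2 k)

lemma listSum_eq_sum_piFinset (α : Fin d → ℕ) (w : Fin d → ℕ → ℝ) (l : List (Fin d))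
    (hl : l.Nodup) (g : (Fin d → ℝ) → ℝ) (x : Fin d → ℝ) :
    listSum α w l g x =
      ∑ k ∈ Fintype.piFinset
          (fun i => if i ∈ l then (univ : Finset (Fin (α i + 1))) else {0}),
        (∏ i ∈ l.toFinset, w i (k i)) *
          g (fun i => if i ∈ l then ((k i : ℕ) : ℝ) / (α i : ℝ) else x i) := by
  induction l generalizing x with
  | nil =>
    have : Fintype.piFinset (fun i : Fin d => ({0} : Finset (Fin (α i + 1)))) = {0} :=
      Fintype.piFinset_singleton _
    simp [listSum, this]
  | cons i l ih =>
    obtain ⟨hil, hl'⟩ := List.nodup_cons.1 hl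
    change ∑ j : Fin (α i + 1), w i j * listSum α w l g _ = _
    simp only [ih hl', Finset.mul_sum]
    rw [← Finset.sum_product']
    refine Finset.sum_nbij' (fun p => Function.update p.2 i p.1)
      (fun k => (k i, Function.update k i 0)) ?_ ?_ ?_ ?_ ?_
    · rintro ⟨j, k⟩ hk
      simp only [mem_product, mem_univ, true_and, Fintype.mem_piFinset] at hk ⊢
      intro a
      rcases eq_or_ne a i with rfl | ha
      · simp
      · simpa [ha] using hk a
    · intro k hk
      simp only [mem_product, mem_univ, true_and, Fintype.mem_piFinset] at hk ⊢
      intro a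
      rcases eq_or_ne a i with rfl | ha
      · simp [hil]
      · simpa [ha] using hk a
    · rintro ⟨j, k⟩ hk
      simp only [mem_product, mem_univ, true_and, Fintype.mem_piFinset] at hk
      have := hk i
      simp only [hil, if_false, mem_singleton] at this
      simp [← this]
    · intro k hk
      simp
    · rintro ⟨j, k⟩ hk
      have hprod : ∏ a ∈ l.toFinset, w a (Function.update k i j a) =
          ∏ a ∈ l.toFinset, w a (k a) := by
        refine Finset.prod_congr rfl fun a ha => ?_
        rw [Function.update_of_ne]
        rintro rfl
        exact hil (by simpa using ha)
      rw [List.toFinset_cons, Finset.prod_insert (by simpa using hil), hprod]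
      simp only [Function.update_self]
      rw [← mul_assoc]
      congr 2
      funext a
      rcases eq_or_ne a i with rfl | ha
      · simp [hil]
      · simp [ha]

lemma listSum_finRange (α : Fin d → ℕ) (w : Fin d → ℕ → ℝ) (g : (Fin d → ℝ) → ℝ)
    (x : Fin d → ℝ) :
    listSum α w (List.finRange d) g x =
      ∑ k : (i : Fin d) → Fin (α i + 1),
        (∏ i, w i (k i)) * g (fun i => ((k i : ℕ) : ℝ) / (α i : ℝ)) := by
  rw [listSum_eq_sum_piFinset α w _ (List.nodup_finRange d)]
  simp

lemma partialDeriv_sum_prod_eval {K : Type*} [Fintype K] (c : K → ℝ) (q : K → Fin d → ℝ[X])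
    (i : Fin d) :
    partialDeriv d i (fun x => ∑ k, c k * ∏ j, (q k j).eval (x j)) =
      fun x => ∑ k, c k *
        ∏ j, (Function.update (q k) i (derivative (q k i)) j).eval (x j) := by
  funext x
  refine HasDerivAt.deriv (HasDerivAt.fun_sum fun k _ => HasDerivAt.const_mul (c k) ?_)
  have h := ((q k i).hasDerivAt (x i)).mul_const (∏ j ∈ univ.erase i, (q k j).eval (x j))
  convert h using 1
  · funext t
    rw [← Finset.mul_prod_erase univ _ (Finset.mem_univ i)]
    simp only [Function.update_self]
    congr 1
    refine Finset.prod_congr rfl fun j hj => ?_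
    rw [Function.update_of_ne (Finset.ne_of_mem_erase hj)]
  · rw [← Finset.mul_prod_erase univ _ (Finset.mem_univ i)]
    simp only [Function.update_self]
    congr 1
    refine Finset.prod_congr rfl fun j hj => ?_
    rw [Function.update_of_ne (Finset.ne_of_mem_erase hj)]

lemma iterate_partialDeriv_sum_prod_eval {K : Type*} [Fintype K] (c : K → ℝ)
    (q : K → Fin d → ℝ[X]) (i : Fin d) (m : ℕ) :
    (partialDeriv d i)^[m] (fun x => ∑ k, c k * ∏ j, (q k j).eval (x j)) =
      fun x => ∑ k, c k *
        ∏ j, (Function.update (q k) i (derivative^[m] (q k i)) j).eval (x j) := by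
  induction m with
  | zero => simp
  | succ m ih =>
    rw [Function.iterate_succ_apply', ih, partialDeriv_sum_prod_eval]
    simp only [Function.update_self, Function.update_idem, Function.iterate_succ_apply']

lemma listPartial_sum_prod_eval {K : Type*} [Fintype K] (c : K → ℝ)
    (q : K → Fin d → ℝ[X]) (β : Fin d → ℕ) (l : List (Fin d)) (hl : l.Nodup) :
    listPartial β l (fun x => ∑ k, c k * ∏ j, (q k j).eval (x j)) =
      fun x => ∑ k, c k *
        ∏ j, (if j ∈ l then derivative^[β j] (q k j) else q k j).eval (x j) := by
  induction l with
  | nil => simp [listPartial]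
  | cons i l ih =>
    obtain ⟨hil, hl'⟩ := List.nodup_cons.1 hl
    change (partialDeriv d i)^[β i] (listPartial β l _) = _
    rw [ih hl', iterate_partialDeriv_sum_prod_eval c
      (fun k j => if j ∈ l then derivative^[β j] (q k j) else q k j)]
    funext x
    refine Finset.sum_congr rfl fun k _ => ?_
    congr 1
    refine Finset.prod_congr rfl fun j _ => ?_
    rcases eq_or_ne j i with rfl | hj
    · simp [hil]
    · simp [hj]

lemma multiBernstein_eq (α : Fin d → ℕ) (f : (Fin d → ℝ) → ℝ) :
    multiBernstein d α f = fun x => ∑ k : (i : Fin d) → Fin (α i + 1),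
      f (fun i => ((k i : ℕ) : ℝ) / (α i : ℝ)) *
        ∏ i, (bernsteinPolynomial ℝ (α i) (k i)).eval (x i) := by
  funext x
  refine Finset.sum_congr rfl fun k _ => ?_
  rw [mul_comm (∏ i, ((α i).choose (k i) : ℝ)), mul_assoc, ← Finset.prod_mul_distrib]
  congr 1
  refine Finset.prod_congr rfl fun i _ => ?_
  simp [bernsteinPolynomial, mul_assoc]

lemma mixedPartial_multiBernstein_eq_listSum (α β : Fin d → ℕ) (f : (Fin d → ℝ) → ℝ)
    (x z : Fin d → ℝ) :
    mixedPartial d β (multiBernstein d α f) x =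
      listSum α (fun i k => (derivative^[β i] (bernsteinPolynomial ℝ (α i) k)).eval (x i))
        (List.finRange d) f z := by
  change listPartial β (List.finRange d) _ x = _
  rw [multiBernstein_eq, listSum_finRange,
    listPartial_sum_prod_eval _ (fun (k : (i : Fin d) → Fin (α i + 1)) i =>
      bernsteinPolynomial ℝ (α i) (k i)) β _ (List.nodup_finRange d)]
  simp [mul_comm]

lemma listPartial_congr {β γ : Fin d → ℕ} {l : List (Fin d)} (h : ∀ i ∈ l, γ i = β i)
    (g : (Fin d → ℝ) → ℝ) : listPartial γ l g = listPartial β l g := by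
  induction l with
  | nil => rfl
  | cons i l ih =>
    change (partialDeriv d i)^[γ i] (listPartial γ l g) =
      (partialDeriv d i)^[β i] (listPartial β l g)
    rw [ih fun j hj => h j (List.mem_cons_of_mem _ hj), h i List.mem_cons_self]

lemma listPartial_zero (l : List (Fin d)) (g : (Fin d → ℝ) → ℝ) : listPartial 0 l g = g := by
  induction l with
  | nil => rfl
  | cons i l ih => exact ih

lemma HasContMixedPartials.differentiableAt_iterate {β : Fin d → ℕ} {f : (Fin d → ℝ) → ℝ}
    (hf : HasContMixedPartials d β f) {l₁ : List (Fin d)} {i : Fin d} {l₂ : List (Fin d)}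
    (hl : List.finRange d = l₁ ++ i :: l₂) {j : ℕ} (hj : j < β i) (x : Fin d → ℝ) :
    DifferentiableAt ℝ
      (fun t => (partialDeriv d i)^[j] (listPartial β l₂ f) (Function.update x i t)) (x i) := by
  have hnd : (l₁ ++ i :: l₂).Nodup := hl ▸ List.nodup_finRange d
  obtain ⟨-, h2, hdisj⟩ := List.nodup_append'.1 hnd
  obtain ⟨hil₂, -⟩ := List.nodup_cons.1 h2
  have hil₁ : i ∉ l₁ := fun h => hdisj h List.mem_cons_self
  set γ : Fin d → ℕ := fun k => if k ∈ l₁ then 0 else if k = i then j else β k with hγ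
  have hγi : γ i = j := by simp [hγ, hil₁]
  have hle : γ ≤ β := by
    intro k
    simp only [hγ]
    split_ifs with h1 h2
    · exact Nat.zero_le _
    · exact h2 ▸ hj.le
    · exact le_rfl
  have heq : mixedPartial d γ f = (partialDeriv d i)^[j] (listPartial β l₂ f) := by
    change listPartial γ (List.finRange d) f = _
    rw [hl]
    have happ : listPartial γ (l₁ ++ i :: l₂) f =
        listPartial γ l₁ ((partialDeriv d i)^[γ i] (listPartial γ l₂ f)) := by
      simp [listPartial]
    rw [happ, hγi, listPartial_congr (β := 0) (l := l₁) (fun k hk => by simp [hγ, hk]),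
      listPartial_zero, listPartial_congr (β := β) (l := l₂)]
    intro k hk
    have hk1 : k ∉ l₁ := fun h => hdisj h (List.mem_cons_of_mem _ hk)
    have hki : k ≠ i := fun h => hil₂ (h ▸ hk)
    simp [hγ, hk1, hki]
  rw [← heq]
  exact (hf γ hle).2 i (by rwa [hγi]) x

end Quadrature

/-- If all mixed partials `∂^γ f`, `γ ≤ β`, exist and are continuous, then for every
multiindex `α` with `α i > β i` for all `i`,
`sup_{x ∈ [0,1]^d} |∂^β B_α(f)(x)| ≤ sup_{x ∈ [0,1]^d} |∂^β f(x)|`. -/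
theorem mixedPartial_multiBernstein_bound (d : ℕ) (hd : 1 ≤ d) (β : Fin d → ℕ)
    (f : (Fin d → ℝ) → ℝ) (hf : HasContMixedPartials d β f)
    (α : Fin d → ℕ) (hβα : ∀ i, β i < α i) :
    (⨆ x : Set.Icc (0 : Fin d → ℝ) 1, |mixedPartial d β (multiBernstein d α f) x|)
      ≤ ⨆ x : Set.Icc (0 : Fin d → ℝ) 1, |mixedPartial d β f x| := by
  have : Nonempty (Set.Icc (0 : Fin d → ℝ) 1) := ⟨⟨0, le_rfl, zero_le_one⟩⟩
  have hbdd : BddAbove (Set.range fun x : Set.Icc (0 : Fin d → ℝ) 1 => |mixedPartial d β f x|) :=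
    isCompact_range (((hf β le_rfl).1.abs).comp continuous_subtype_val) |>.bddAbove
  refine ciSup_le fun x => ?_
  rw [mixedPartial_multiBernstein_eq_listSum α β f x 0]
  exact abs_listSum_le α β hβα x.2 _ (List.finRange d) (List.nodup_finRange d) f
    (fun l₁ i l₂ h j hj z => hf.differentiableAt_iterate h hj z)
    (fun z hz => le_ciSup hbdd ⟨z, hz⟩) ⟨le_rfl, zero_le_one⟩
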